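/- arXiv:2603.10728 — 2 statements merged into one kernel-verified Lean document; each statement's English description precedes it below -/
import Mathlib

section
/- For all integers B, A₁ and A₂, h̃_B · h̃_{A₁} · h̃_{A₂} − h̃_B · h̃_{A₁−1} · h̃_{A₂−1} = h̃_B · h̃_{A₁+A₂} in V. -/
open Finsupp

/-- `V` is the free ℤ-module with basis indexed by ℤ (finitely supported functions ℤ → ℤ). -/
abbrev V : Type := ℤ →₀ ℤ

/-- The basis element `h̃_j`. -/
noncomputable def ht (j : ℤ) : V := Finsupp.single j 1

/-- The product of two basis elements `h̃_A · h̃_B`: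
`∑_{j=0}^{A} h̃_{B−A+2j}` for `A ≥ 0`; `0` for `A = −1`; `−(h̃_{−A−2} · h̃_B)` for `A ≤ −2`. -/
noncomputable def basicMul (A B : ℤ) : V :=
  if 0 ≤ A then ∑ j ∈ Finset.range (A.toNat + 1), ht (B - A + 2 * (j : ℤ))
  else if A = -1 then 0
  else - ∑ j ∈ Finset.range ((-A - 2).toNat + 1), ht (B - (-A - 2) + 2 * (j : ℤ))

/-- The ℤ-bilinear product on `V` extending `basicMul` on basis elements. -/
noncomputable def mulV (g₁ g₂ : V) : V :=
  g₁.sum fun A cA => g₂.sum fun B cB => (cA * cB) • basicMul A B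

/-- The shift operator `S_k`, with `S_k(h̃_j) = h̃_{j+k}`. -/
noncomputable def S (k : ℤ) (g : V) : V := Finsupp.mapDomain (fun j => j + k) g

/-- Value of the map `L` on the basis element `h̃_j`. -/
noncomputable def Lb (j : ℤ) : V :=
  if 0 ≤ j then ht j else if j = -1 then 0 else - ht (-j - 2)

/-- The ℤ-linear map `L : V → V` with `L(h̃_j) = h̃_j` for `j ≥ 0`,
`L(h̃_{−1}) = 0`, `L(h̃_j) = −h̃_{−j−2}` for `j ≤ −2`. -/
noncomputable def Lmap (g : V) : V := g.sum fun j c => c • Lb j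

/-- `W₀(g₁,g₂,g₃) = g₂ · (g₁ · g₃ − S_{−1}(g₁) · S_{−1}(g₃))`. -/
noncomputable def W0 (g₁ g₂ g₃ : V) : V :=
  mulV g₂ (mulV g₁ g₃ - mulV (S (-1) g₁) (S (-1) g₃))

/-- `W₁(g₁,g₂,g₃) = S_{−1}(g₁)·g₂·g₃ + g₁·g₂·S_{−1}(g₃) − S_{−1}(g₁)·g₂·S_{−1}(g₃)`
(products associated to the left). -/
noncomputable def W1 (g₁ g₂ g₃ : V) : V :=
  mulV (mulV (S (-1) g₁) g₂) g₃ + mulV (mulV g₁ g₂) (S (-1) g₃)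
    - mulV (mulV (S (-1) g₁) g₂) (S (-1) g₃)

/-- The multiset (Minkowski) sum `M₁ + M₂ = {i₁ + i₂ : i₁ ∈ M₁, i₂ ∈ M₂}`
counted with multiplicity. -/
def msAdd (M₁ M₂ : Multiset ℤ) : Multiset ℤ := M₁.bind fun a => M₂.map fun b => a + b

/-- The multiset `[a, b] = {a, a+2, …, b−2, b}` (for `a ≤ b` with `a ≡ b (mod 2)`). -/
def iv (a b : ℤ) : Multiset ℤ :=
  (Multiset.range (((b - a) / 2).toNat + 1)).map fun j => a + 2 * (j : ℤ)

/-- `R(c)`: the set of finite multisets `M` of integers with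
`mult(c−i−1, M) ≤ mult(c−i, M) ≤ mult(c+i, M)` for all `i ≥ 0`. -/
def Rset (c : ℤ) : Set (Multiset ℤ) :=
  {M | ∀ i : ℤ, 0 ≤ i →
    M.count (c - i - 1) ≤ M.count (c - i) ∧ M.count (c - i) ≤ M.count (c + i)}

/-- `h̃(M) = ∑_{i ∈ ℤ} mult(i, M) · h̃_i ∈ V`. -/
noncomputable def hMS (M : Multiset ℤ) : V := (M.map ht).sum

/-- The triple `(ẽ(n,0,0), ẽ(n,1,0), ẽ(n,−1,0))`. -/
noncomputable def eZ : ℕ → V × V × V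
  | 0 => (ht 2, ht 1, ht 1)
  | n + 1 =>
    let e0 := (eZ n).1
    let e1 := (eZ n).2.1
    let em := (eZ n).2.2
    (mulV e0 (mulV e0 e0 - mulV e1 e1),
     mulV (mulV e1 e0) e0 + mulV (mulV e0 e0) e1
       - mulV (mulV (mulV e1 (ht 1)) e0) e1,
     mulV (mulV e1 e0) e0 + mulV (mulV e0 e0) e1
       - mulV (mulV (mulV e1 (ht 1)) e0) e1
       + mulV (mulV em em) (em - e1))

/-- The triple `(ẽ(n,0,1), ẽ(n,1,1), ẽ(n,−1,1))`. -/
noncomputable def eO : ℕ → V × V × V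
  | 0 => (0, 0, ht 0)
  | n + 1 =>
    let e0 := (eZ n).1
    let e1 := (eO n).1
    let o1 := (eO n).2.1
    let om := (eO n).2.2
    (W0 e0 e0 (e1 + S (-1) e0) + W0 e0 e1 e0 + W0 e1 e0 e0,
     W1 e0 e0 (e1 + S (-1) e0) + W1 e0 e1 e0 + W1 e1 e0 e0,
     W1 e0 e0 (e1 + S (-1) e0) + W1 e0 e1 e0
       + mulV (mulV om e0) e0 + mulV (mulV e1 e0) (S (-1) e0)
       - mulV (mulV (mulV om (ht 1)) e0) (S (-1) e0)
       + (2 : ℤ) • mulV (mulV (S (-1) e0) e0) (S (-1) e0)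
       - mulV (mulV (mulV (S (-1) e0) (ht 1)) (S (-1) e0)) (S (-1) e0)
       + mulV (mulV (S (-1) e0) (om - o1)) (S (-1) e0))

/-- `ẽ(n, i, 0)` for `i ∈ {−1, 0, 1}`. -/
noncomputable def etilde0 (n : ℕ) (i : ℤ) : V :=
  if i = 0 then (eZ n).1 else if i = 1 then (eZ n).2.1 else (eZ n).2.2

/-- `ẽ(n, i, 1)` for `i ∈ {−1, 0, 1}`. -/
noncomputable def etilde1 (n : ℕ) (i : ℤ) : V :=
  if i = 0 then (eO n).1 else if i = 1 then (eO n).2.1 else (eO n).2.2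

theorem mulV_ht_right (g : V) (C : ℤ) :
    mulV g (ht C) = g.sum fun A c => c • basicMul A C := by
  simp [mulV, ht]

theorem mulV_ht_ht (A C : ℤ) : mulV (ht A) (ht C) = basicMul A C := by
  simp [mulV, ht]

theorem S_ht (k j : ℤ) : S k (ht j) = ht (j + k) := by
  simp [S, ht]

/-- The shift operators commute with multiplication on the left by a basis element. -/
theorem S_basicMul (k A C : ℤ) : S k (basicMul A C) = basicMul A (C + k) := by
  have hsum : ∀ (n : ℕ) (D : ℤ), S k (∑ j ∈ Finset.range n, ht (C - D + 2 * (j : ℤ))) =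
      ∑ j ∈ Finset.range n, ht (C + k - D + 2 * (j : ℤ)) := by
    intro n D
    simp only [S, Finsupp.mapDomain_finsetSum]
    refine Finset.sum_congr rfl fun j _ => ?_
    rw [← S, S_ht]
    congr 1
    ring
  have hneg (x : V) : S k (-x) = -S k x :=
    map_neg (Finsupp.mapDomain.addMonoidHom (M := ℤ) fun j : ℤ => j + k) x
  unfold basicMul
  split_ifs
  · exact hsum _ _
  · exact Finsupp.mapDomain_zero
  · rw [hneg, hsum]

theorem basicMul_sub_basicMul (A C : ℤ) :
    basicMul A C - basicMul (A - 1) (C - 1) = ht (A + C) := by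
  rcases lt_trichotomy A 0 with hA | rfl | hA
  · rcases eq_or_ne A (-1) with rfl | hA'
    · norm_num [basicMul]
      congr 1
      ring
    · obtain ⟨n, rfl⟩ : ∃ n : ℕ, A = -(n : ℤ) - 2 := ⟨(-A - 2).toNat, by omega⟩
      have h₁ : (-(-(n : ℤ) - 2) - 2).toNat = n := by omega
      have h₂ : (-(-(n : ℤ) - 2 - 1) - 2).toNat = n + 1 := by omega
      rw [basicMul, if_neg (by omega), if_neg (by omega), basicMul, if_neg (by omega),
        if_neg (by omega), h₁, h₂, Finset.sum_range_succ' _ (n + 1), sub_neg_eq_add,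
        neg_add_eq_iff_eq_add]
      congr 1
      · refine Finset.sum_congr rfl fun j _ => ?_
        congr 1
        push_cast
        ring
      · congr 1
        push_cast
        ring
  · simp [basicMul]
  · obtain ⟨n, rfl⟩ : ∃ n : ℕ, A = (n : ℤ) + 1 := ⟨(A - 1).toNat, by omega⟩
    have h₁ : ((n : ℤ) + 1).toNat = n + 1 := by omega
    have h₂ : ((n : ℤ) + 1 - 1).toNat = n := by omega
    rw [basicMul, if_pos (by omega), basicMul, if_pos (by omega), h₁, h₂,
      Finset.sum_range_succ _ (n + 1), sub_eq_iff_eq_add, add_comm]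
    congr 1
    · congr 1
      push_cast
      ring
    · refine Finset.sum_congr rfl fun j _ => ?_
      congr 1
      ring

theorem mulV_ht_sub_mulV_S_ht (g : V) (C : ℤ) :
    mulV g (ht C) - mulV (S (-1) g) (ht (C - 1)) = S C g := by
  rw [mulV_ht_right, mulV_ht_right, S,
    Finsupp.sum_mapDomain_index (by simp) (by simp [add_smul]), ← Finsupp.sum_sub, S,
    Finsupp.mapDomain]
  refine Finsupp.sum_congr fun A _ => ?_
  rw [← smul_sub, ← sub_eq_add_neg, basicMul_sub_basicMul, ht, Finsupp.smul_single, smul_eq_mul,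
    mul_one]

/-- For all integers `B, A₁, A₂`,
`h̃_B · h̃_{A₁} · h̃_{A₂} − h̃_B · h̃_{A₁−1} · h̃_{A₂−1} = h̃_B · h̃_{A₁+A₂}` in `V`. -/
theorem stmt2 (B A₁ A₂ : ℤ) :
    mulV (mulV (ht B) (ht A₁)) (ht A₂) - mulV (mulV (ht B) (ht (A₁ - 1))) (ht (A₂ - 1))
      = mulV (ht B) (ht (A₁ + A₂)) := by
  rw [mulV_ht_ht, mulV_ht_ht, mulV_ht_ht, sub_eq_add_neg A₁, ← S_basicMul,
    mulV_ht_sub_mulV_S_ht, S_basicMul]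
end

section
/- For every integer n ≥ 0, ẽ(n, 1, 0) = S_{−1}(ẽ(n, 0, 0)). -/
open Finsupp

open scoped LaurentPolynomial

/-- The linear isomorphism from `V` to Laurent polynomials sending `h̃_j` to `T j`. -/
noncomputable def toLaurentV : V ≃ₗ[ℤ] ℤ[T;T⁻¹] :=
  (AddMonoidAlgebra.coeffLinearEquiv ℤ).symm

/-- The character map: the linear map sending `h̃_A` to the Laurent polynomial by which
`h̃_A · -` multiplies. -/
noncomputable def characterV : V →ₗ[ℤ] ℤ[T;T⁻¹] :=
  Finsupp.linearCombination ℤ fun A => toLaurentV (basicMul A 0)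

lemma toLaurentV_ht (j : ℤ) : toLaurentV (ht j) = LaurentPolynomial.T j := rfl

lemma characterV_ht (A : ℤ) : characterV (ht A) = toLaurentV (basicMul A 0) := by
  simp [characterV, ht]

lemma toLaurentV_basicMul (A B : ℤ) :
    toLaurentV (basicMul A B) = toLaurentV (basicMul A 0) * LaurentPolynomial.T B := by
  unfold basicMul
  split_ifs
  · simp only [map_sum, toLaurentV_ht, Finset.sum_mul, ← LaurentPolynomial.T_add]
    exact Finset.sum_congr rfl fun j _ => by congr 1; ring
  · simp
  · simp only [map_neg, map_sum, toLaurentV_ht, neg_mul, Finset.sum_mul,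
      ← LaurentPolynomial.T_add]
    exact congrArg _ (Finset.sum_congr rfl fun j _ => by congr 1; ring)

lemma toLaurentV_mulV (f g : V) : toLaurentV (mulV f g) = characterV f * toLaurentV g := by
  have hg : toLaurentV g = g.sum fun B c => c • LaurentPolynomial.T B := by
    conv_lhs => rw [← Finsupp.sum_single g]
    simp only [Finsupp.sum, map_sum]
    refine Finset.sum_congr rfl fun B _ => ?_
    rw [← toLaurentV_ht, ← map_smul, ht, Finsupp.smul_single_one]
  rw [hg, characterV, Finsupp.linearCombination_apply]
  simp only [mulV, Finsupp.sum, map_sum, map_smul, Finset.sum_mul_sum, smul_mul_smul_comm]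
  exact Finset.sum_congr rfl fun A _ => Finset.sum_congr rfl fun B _ => by
    rw [toLaurentV_basicMul]

lemma T_sub_T_mul_sum (n : ℕ) :
    (LaurentPolynomial.T 1 - LaurentPolynomial.T (-1) : ℤ[T;T⁻¹]) *
      ∑ j ∈ Finset.range (n + 1), LaurentPolynomial.T (0 - (n : ℤ) + 2 * (j : ℤ)) =
    LaurentPolynomial.T ((n : ℤ) + 1) - LaurentPolynomial.T (-(n : ℤ) - 1) := by
  have h (j : ℕ) : (LaurentPolynomial.T 1 - LaurentPolynomial.T (-1) : ℤ[T;T⁻¹]) *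
      LaurentPolynomial.T (0 - (n : ℤ) + 2 * (j : ℤ)) =
      LaurentPolynomial.T (-(n : ℤ) - 1 + 2 * ((j + 1 : ℕ) : ℤ)) -
        LaurentPolynomial.T (-(n : ℤ) - 1 + 2 * (j : ℤ)) := by
    rw [sub_mul, ← LaurentPolynomial.T_add, ← LaurentPolynomial.T_add]
    congr 2 <;> push_cast <;> ring
  rw [Finset.mul_sum, Finset.sum_congr rfl fun j _ => h j,
    Finset.sum_range_sub fun j : ℕ =>
      (LaurentPolynomial.T (-(n : ℤ) - 1 + 2 * (j : ℤ)) : ℤ[T;T⁻¹])]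
  congr 2 <;> push_cast <;> ring

lemma T_sub_T_mul_characterV_ht (A : ℤ) :
    (LaurentPolynomial.T 1 - LaurentPolynomial.T (-1)) * characterV (ht A) =
      LaurentPolynomial.T (A + 1) - LaurentPolynomial.T (-A - 1) := by
  rw [characterV_ht, basicMul]
  split_ifs with h₀ h₁
  · lift A to ℕ using h₀
    simpa only [map_sum, toLaurentV_ht, Int.toNat_natCast] using T_sub_T_mul_sum A
  · simp [h₁]
  · obtain ⟨n, hn⟩ := Int.eq_ofNat_of_zero_le (show 0 ≤ -A - 2 by omega)
    rw [hn]
    simp only [map_neg, map_sum, toLaurentV_ht, Int.toNat_natCast, mul_neg, T_sub_T_mul_sum]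
    rw [neg_sub]
    congr 2 <;> omega

/-- The Weyl character formula: `(x - x⁻¹) χ(g) = x g(x) - x⁻¹ g(x⁻¹)`. -/
lemma T_sub_T_mul_characterV (g : V) :
    (LaurentPolynomial.T 1 - LaurentPolynomial.T (-1)) * characterV g =
      LaurentPolynomial.T 1 * toLaurentV g -
        LaurentPolynomial.T (-1) * LaurentPolynomial.invert (toLaurentV g) := by
  induction g using Finsupp.induction_linear with
  | zero => simp
  | add f g hf hg => simp only [map_add, mul_add, hf, hg]; ring
  | single A c =>
    have h : (Finsupp.single A c : V) = c • ht A := by simp [ht]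
    rw [h]
    simp only [map_smul, mul_smul_comm, ← smul_sub, T_sub_T_mul_characterV_ht, toLaurentV_ht,
      LaurentPolynomial.invert_T, ← LaurentPolynomial.T_add]
    congr 3 <;> ring

lemma T_sub_T_ne_zero :
    (LaurentPolynomial.T 1 - LaurentPolynomial.T (-1) : ℤ[T;T⁻¹]) ≠ 0 := by
  intro h
  have := congrArg (fun p : ℤ[T;T⁻¹] => p.coeff 1) h
  simp at this

lemma invert_characterV (g : V) :
    LaurentPolynomial.invert (characterV g) = characterV g := by
  apply mul_left_cancel₀ T_sub_T_ne_zero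
  have h := congrArg LaurentPolynomial.invert (T_sub_T_mul_characterV g)
  simp only [map_mul, map_sub, LaurentPolynomial.invert_T, neg_neg,
    LaurentPolynomial.involutive_invert (toLaurentV g)] at h
  linear_combination -h - T_sub_T_mul_characterV g

lemma characterV_mulV (f g : V) : characterV (mulV f g) = characterV f * characterV g := by
  apply mul_left_cancel₀ T_sub_T_ne_zero
  have h := T_sub_T_mul_characterV (mulV f g)
  rw [toLaurentV_mulV, map_mul, invert_characterV] at h
  linear_combination h - characterV f * T_sub_T_mul_characterV g

lemma toLaurentV_S (k : ℤ) (g : V) :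
    toLaurentV (S k g) = LaurentPolynomial.T k * toLaurentV g := by
  induction g using Finsupp.induction_linear with
  | zero => simp [S]
  | add f g hf hg =>
    simp only [S, map_add, mul_add] at *
    rw [Finsupp.mapDomain_add, map_add, hf, hg]
  | single A c =>
    have h (j : ℤ) : (Finsupp.single j c : V) = c • ht j := by simp [ht]
    rw [S, Finsupp.mapDomain_single, h, h]
    simp only [map_smul, toLaurentV_ht, mul_smul_comm, ← LaurentPolynomial.T_add, add_comm]

lemma characterV_ht_one :
    characterV (ht 1) = LaurentPolynomial.T 1 + LaurentPolynomial.T (-1) := by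
  rw [characterV_ht]
  simp [basicMul, Finset.sum_range_succ, toLaurentV_ht, add_comm]

lemma eZ_snd_fst (n : ℕ) : (eZ n).2.1 = S (-1) (eZ n).1 := by
  induction n with
  | zero => simp [eZ, S, ht]
  | succ n ih =>
    apply toLaurentV.injective
    have hT : (LaurentPolynomial.T 1 * LaurentPolynomial.T (-1) : ℤ[T;T⁻¹]) = 1 := by
      rw [← LaurentPolynomial.T_add]; simp
    simp only [eZ]
    rw [toLaurentV_S]
    simp only [map_add, map_sub, toLaurentV_mulV, characterV_mulV, characterV_ht_one]
    rw [ih, toLaurentV_S]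
    linear_combination
      (-characterV (S (-1) (eZ n).1) * characterV (eZ n).1 * toLaurentV (eZ n).1) * hT

/-- For every `n ≥ 0`, `ẽ(n, 1, 0) = S_{−1}(ẽ(n, 0, 0))`. -/
theorem stmt11 (n : ℕ) : etilde0 n 1 = S (-1) (etilde0 n 0) := by
  simpa [etilde0] using eZ_snd_fst n
end
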